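/- Let f be a nonzero element of the k-linear span of the set {x^{jq+i} : q > i > j ≥ 0 and jq+i ≡ 1 (mod q−1)} in k[x]₀. Then W_1 + {f}^S = k[x]₀. -/

import Mathlib

open Polynomial

variable (k : Type*) [Field k] [Fintype k]

/-- `k[x]₀`: the free non-unital associative `k`-algebra on one generator `x`,
identified with the polynomials over `k` with zero constant term,
viewed as a `k`-submodule of `Polynomial k`. -/
noncomputable def A0 : Submodule k (Polynomial k) :=
  LinearMap.ker (Polynomial.aeval (0 : k)).toLinearMap

/-- A `T`-space of `k[x]₀`: a `k`-linear subspace of `k[x]₀` closed under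
substitutions `f ↦ f ∘ g` for `g ∈ k[x]₀`. -/
def IsTSpace (V : Submodule k (Polynomial k)) : Prop :=
  V ≤ A0 k ∧ ∀ f ∈ V, ∀ g ∈ A0 k, f.comp g ∈ V

/-- `H^S`: the smallest `T`-space of `k[x]₀` containing `H`. -/
noncomputable def TSp (H : Set (Polynomial k)) : Submodule k (Polynomial k) :=
  sInf {V | IsTSpace k V ∧ H ⊆ V}

/-- A `T`-ideal of `k[x]₀`: a `T`-space that is also an ideal of `k[x]₀`. -/
def IsTIdeal (V : Submodule k (Polynomial k)) : Prop :=
  IsTSpace k V ∧ ∀ f ∈ V, ∀ g ∈ A0 k, g * f ∈ V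

/-- `H^T`: the smallest `T`-ideal of `k[x]₀` containing `H`. -/
noncomputable def TId (H : Set (Polynomial k)) : Submodule k (Polynomial k) :=
  sInf {V | IsTIdeal k V ∧ H ⊆ V}

/-- `W_n = {x + x^{q^n}}^S + {x^{q^n+1}}^S`, where `q` is the order of `k`. -/
noncomputable def Wn (n : ℕ) : Submodule k (Polynomial k) :=
  TSp k {X + X ^ (Fintype.card k ^ n)} ⊔ TSp k {X ^ (Fintype.card k ^ n + 1)}

/-- `U_n = {x - x^{q^{2n}}}^T`, where `q` is the order of `k`. -/
noncomputable def Un (n : ℕ) : Submodule k (Polynomial k) :=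
  TId k {X - X ^ (Fintype.card k ^ (2 * n))}


theorem mem_A0_iff (p : Polynomial k) : p ∈ A0 k ↔ p.eval 0 = 0 := by
  simp [A0, Polynomial.aeval_def, Polynomial.eval₂_eq_eval_map]

theorem isTSpace_A0 : IsTSpace k (A0 k) := by
  refine ⟨le_rfl, fun f hf g hg => ?_⟩
  rw [mem_A0_iff] at *
  rw [eval_comp, hg, hf]

theorem TSp_le_A0 {H : Set (Polynomial k)} (hH : H ⊆ A0 k) : TSp k H ≤ A0 k :=
  sInf_le ⟨isTSpace_A0 k, hH⟩

theorem comp_mem_TSp (f g : Polynomial k) (hg : g ∈ A0 k) : f.comp g ∈ TSp k {f} := by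
  rw [TSp, Submodule.mem_sInf]
  rintro V ⟨hV, hf⟩
  exact hV.2 f (hf rfl) g hg

theorem add_frob_mem (g : Polynomial k) (hg : g ∈ A0 k) : g + g ^ Fintype.card k ∈ Wn k 1 := by
  have := comp_mem_TSp k (X + X ^ (Fintype.card k ^ 1)) g hg
  simp only [pow_one, add_comp, X_comp, pow_comp] at this
  exact (le_sup_left : _ ≤ Wn k 1) (by simpa using this)

theorem norm_mem (g : Polynomial k) (hg : g ∈ A0 k) : g ^ (Fintype.card k + 1) ∈ Wn k 1 := by
  have := comp_mem_TSp k (X ^ (Fintype.card k ^ 1 + 1)) g hg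
  simp only [pow_one, X_comp, pow_comp] at this
  exact (le_sup_right : _ ≤ Wn k 1) (by simpa using this)

theorem add_pow_q {R : Type*} [CommRing R] [Algebra k R] (a b : R) :
    (a + b) ^ Fintype.card k = a ^ Fintype.card k + b ^ Fintype.card k :=
  map_add (FiniteField.frobeniusAlgHom k R) a b

theorem neg_pow_q {R : Type*} [CommRing R] [Algebra k R] (a : R) :
    (-a) ^ Fintype.card k = - a ^ Fintype.card k :=
  map_neg (FiniteField.frobeniusAlgHom k R) a

theorem sub_pow_q {R : Type*} [CommRing R] [Algebra k R] (a b : R) :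
    (a - b) ^ Fintype.card k = a ^ Fintype.card k - b ^ Fintype.card k :=
  map_sub (FiniteField.frobeniusAlgHom k R) a b

theorem polar_mem (u v : Polynomial k) (hu : u ∈ A0 k) (hv : v ∈ A0 k) :
    u * v ^ Fintype.card k + u ^ Fintype.card k * v ∈ Wn k 1 := by
  have h := sub_mem (sub_mem (norm_mem k (u + v) (add_mem hu hv)) (norm_mem k u hu)) (norm_mem k v hv)
  convert h using 1
  simp only [pow_succ, add_pow_q]
  ring

theorem X_mem : (X : Polynomial k) ∈ A0 k := by simp [mem_A0_iff]

theorem pow_mem_A0 (u : Polynomial k) (hu : u ∈ A0 k) (n : ℕ) (hn : n ≠ 0) : u ^ n ∈ A0 k := by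
  rw [mem_A0_iff] at *
  simp [hu, hn]

theorem monomial_U_mem (m : ℕ) :
    (X : Polynomial k) ^ m * (X ^ (Fintype.card k ^ 2) - X) ∈ Wn k 1 := by
  have hq : Fintype.card k ≠ 0 := Fintype.card_ne_zero
  have hXq := pow_mem_A0 k X (X_mem k) _ hq
  rcases Nat.eq_zero_or_pos m with rfl | hm
  · have h := sub_mem (add_frob_mem k _ hXq) (add_frob_mem k _ (X_mem k))
    convert h using 1
    rw [← pow_mul]; ring
  · have hu := pow_mem_A0 k X (X_mem k) m hm.ne'
    have h1 := polar_mem k (X ^ m) (X ^ Fintype.card k) hu hXq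
    have h2 := add_frob_mem k (X ^ m * X) (by
      rw [← pow_succ]; exact pow_mem_A0 k X (X_mem k) _ (by omega))
    convert sub_mem h1 h2 using 1
    rw [mul_pow, ← pow_mul X (Fintype.card k) (Fintype.card k)]; ring

theorem U_mem (Q : Polynomial k) : Q * (X ^ (Fintype.card k ^ 2) - X) ∈ Wn k 1 := by
  induction Q using Polynomial.induction_on' with
  | add p r hp hr => rw [add_mul]; exact add_mem hp hr
  | monomial n a =>
    rw [← smul_X_eq_monomial, smul_mul_assoc]
    exact Submodule.smul_mem _ _ (monomial_U_mem k n)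

section
variable {K : Type*} [Field K] [Fintype K] [Algebra k K]
  (hK : Fintype.card K = Fintype.card k ^ 2)

theorem eq_zero_of_vanish (P : Polynomial k) (hd : P.natDegree < Fintype.card K)
    (h : ∀ e : K, aeval e P = 0) : P = 0 := by
  have : P.map (algebraMap k K) = 0 := by
    apply Polynomial.eq_zero_of_natDegree_lt_card_of_eval_eq_zero (ι := K) _
      (f := id) Function.injective_id
    · intro e; rw [id, ← h e, aeval_def, eval₂_eq_eval_map]
    · rwa [natDegree_map]
  exact (Polynomial.map_eq_zero _).1 this

include hK

theorem pow_sq (e : K) : (e ^ Fintype.card k) ^ Fintype.card k = e := by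
  rw [← pow_mul, ← sq, ← hK, FiniteField.pow_card]

theorem mem_W_of_vanish (P : Polynomial k) (h : ∀ e : K, aeval e P = 0) : P ∈ Wn k 1 := by
  have hq : 1 < Fintype.card k ^ 2 := hK ▸ Fintype.one_lt_card
  have hdeg := FiniteField.X_pow_card_sub_X_natDegree_eq k hq
  have hm : (X ^ (Fintype.card k ^ 2) - X : k[X]).Monic := by
    apply monic_X_pow_sub; rw [degree_X]; exact_mod_cast hq
  have hz : P %ₘ (X ^ (Fintype.card k ^ 2) - X) = 0 := by
    apply eq_zero_of_vanish k (K := K)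
    · rw [hK]
      conv_rhs => rw [← hdeg]
      apply natDegree_modByMonic_lt _ hm
      intro h1; rw [h1] at hdeg; simp at hdeg; omega
    · intro e
      have := congrArg (aeval e) (modByMonic_add_div P (X ^ (Fintype.card k ^ 2) - X))
      rw [map_add, map_mul, h e] at this
      simpa [← hK, FiniteField.pow_card] using this
  have := modByMonic_add_div P (X ^ (Fintype.card k ^ 2) - X)
  rw [hz, zero_add, mul_comm] at this
  rw [← this]; exact U_mem k _

theorem mem_W_of_fixed (P : Polynomial k) (hP : P ∈ A0 k)
    (h : ∀ e : K, (aeval e P) ^ Fintype.card k = aeval e P) : P ∈ Wn k 1 := by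
  by_cases h2 : (2 : k) = 0
  · have hev : Fintype.card k % 2 = 0 := by
      apply FiniteField.even_card_of_char_two
      haveI : CharP k 2 := CharTwo.of_one_ne_zero_of_two_eq_zero one_ne_zero h2
      exact ringChar.eq k 2
    obtain ⟨m, hm⟩ : ∃ m, Fintype.card k = m + m := ⟨Fintype.card k / 2, by omega⟩
    have hm0 : m ≠ 0 := by
      rintro rfl; exact Fintype.card_ne_zero hm
    have h1 : P - (P ^ m) ^ (Fintype.card k + 1) ∈ Wn k 1 := by
      apply mem_W_of_vanish k hK
      intro e
      simp only [map_sub, map_pow]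
      rw [pow_succ, ← pow_mul, mul_comm m, pow_mul, h, ← pow_add, ← hm, h, sub_self]
    have := add_mem h1 (norm_mem k (P ^ m) (pow_mem_A0 k P hP m hm0))
    simpa using this
  · have hh : C (2⁻¹ : k) * P ∈ A0 k := by
      rw [mem_A0_iff] at *; simp [hP]
    have h1 : P - (C (2⁻¹ : k) * P + (C (2⁻¹ : k) * P) ^ Fintype.card k) ∈ Wn k 1 := by
      apply mem_W_of_vanish k hK
      intro e
      have h3 : algebraMap k K 2⁻¹ * 2 = 1 := by
        rw [← map_ofNat (algebraMap k K) 2, ← map_mul, inv_mul_cancel₀ h2, map_one]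
      simp only [map_sub, map_add, map_pow, map_mul, aeval_C]
      rw [mul_pow, h, ← map_pow, FiniteField.pow_card]
      linear_combination -(aeval e P) * h3
    have := add_mem h1 (add_frob_mem k _ hh)
    simpa using this

omit hK in
theorem fixed_mem_range (c : K) (hc : c ^ Fintype.card k = c) : c ∈ Set.range (algebraMap k K) := by
  have hs : Splits (X ^ Fintype.card k - X : k[X]) := by
    rw [splits_iff_card_roots, FiniteField.roots_X_pow_card_sub_X, ← Finset.card_def,
      Finset.card_univ, FiniteField.X_pow_card_sub_X_natDegree_eq _ Fintype.one_lt_card]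
  have h1 := FiniteField.roots_X_pow_card_sub_X k ▸ hs.roots_map (algebraMap k K) ▸
    Multiset.mem_map (b := c)
  have h2 : (X ^ Fintype.card k - X : K[X]) ≠ 0 :=
    FiniteField.X_pow_card_sub_X_ne_zero K Fintype.one_lt_card
  have h3 := h1.1 (by simp [h2, hc])
  obtain ⟨a, _, ha⟩ := h3
  exact ⟨a, ha⟩

theorem exists_bump (c d : K) (hd : d ^ Fintype.card k ≠ d) :
    ∃ P : k[X], P ∈ A0 k ∧ aeval d P = c ∧ aeval (d ^ Fintype.card k) P = c ^ Fintype.card k ∧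
      ∀ e, e ≠ d → e ≠ d ^ Fintype.card k → aeval e P = 0 := by
  set N := Fintype.card K - 1 with hN
  have hN0 : N ≠ 0 := by have : 1 < Fintype.card K := Fintype.one_lt_card; omega
  set R : K[X] := C c * (1 - (X - C d) ^ N) +
    C (c ^ Fintype.card k) * (1 - (X - C (d ^ Fintype.card k)) ^ N) with hR
  have hfix : R.map (FiniteField.frobeniusAlgHom k K : K →+* K) = R := by
    have hF : ∀ x : K, (FiniteField.frobeniusAlgHom k K) x = x ^ Fintype.card k := fun x => rfl
    simp only [hR, Polynomial.map_add, Polynomial.map_mul, Polynomial.map_sub, Polynomial.map_pow,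
      map_C, map_X, Polynomial.map_one, RingHom.coe_coe, hF, pow_sq k hK]
    ring
  have hl : R ∈ lifts (algebraMap k K) := by
    rw [lifts_iff_coeff_lifts]
    intro n
    apply fixed_mem_range
    conv_rhs => rw [← hfix]
    rw [coeff_map]; rfl
  obtain ⟨P, hP⟩ := (mem_lifts _).1 hl
  have hev : ∀ e : K, aeval e P = R.eval e := by
    intro e; rw [← hP, aeval_def, eval₂_eq_eval_map]
  have hz : ∀ e : K, e ≠ d → e ≠ d ^ Fintype.card k → aeval e P = 0 := by
    intro e h1 h2
    rw [hev, hR]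
    simp [FiniteField.pow_card_sub_one_eq_one _ (sub_ne_zero.2 h1),
      FiniteField.pow_card_sub_one_eq_one _ (sub_ne_zero.2 h2), hN]
  refine ⟨P, ?_, ?_, ?_, hz⟩
  · rw [mem_A0_iff]
    have h0 : d ≠ 0 := by
      rintro rfl; simp at hd
    have := hz 0 h0.symm (pow_ne_zero _ h0).symm
    have h4 : aeval (0 : K) P = algebraMap k K (P.eval 0) := by
      rw [← map_zero (algebraMap k K), aeval_algebraMap_apply]; simp
    rw [h4] at this
    simpa using this
  · rw [hev, hR]
    simp [FiniteField.pow_card_sub_one_eq_one _ (sub_ne_zero.2 hd.symm), hN, hN0]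
    rw [← hN]; simp [hN0]
  · rw [hev, hR]
    simp [FiniteField.pow_card_sub_one_eq_one _ (sub_ne_zero.2 hd), hN, hN0]
    rw [← hN]; simp [hN0]

theorem aeval_frob (P : k[X]) (e : K) :
    aeval (e ^ Fintype.card k) P = (aeval e P) ^ Fintype.card k :=
  aeval_algHom_apply (FiniteField.frobeniusAlgHom k K) e P

theorem main_aux (f : k[X]) (hf : f ∈ A0 k) (c : K)
    (hc : (aeval c f) ^ Fintype.card k ≠ aeval c f) (P : k[X]) (hP : P ∈ A0 k) :
    P ∈ Wn k 1 ⊔ TSp k {f} := by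
  classical
  letI : LinearOrder K := WellOrderingRel.isWellOrder.linearOrder
  set q := Fintype.card k with hq
  set t := aeval c f with ht
  have hf0 : aeval (0 : K) f = 0 := by
    rw [← map_zero (algebraMap k K), aeval_algebraMap_apply]
    rw [mem_A0_iff] at hf
    simp [hf]
  have hδ : t - t ^ q ≠ 0 := sub_ne_zero.2 hc.symm
  have hb : ∀ e : K, ∃ b : k, algebraMap k K b * (t - t ^ q) = aeval e P - (aeval e P) ^ q := by
    intro e
    obtain ⟨b, hb⟩ := fixed_mem_range k ((aeval e P - (aeval e P) ^ q) / (t - t ^ q)) (by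
      rw [div_pow, sub_pow_q, sub_pow_q, pow_sq k hK, pow_sq k hK, ← neg_sub, ← neg_sub t,
        neg_div_neg_eq])
    exact ⟨b, by rw [hb, div_mul_cancel₀ _ hδ]⟩
  choose b hb using hb
  have hg : ∀ d : K, ∃ g : k[X], g ∈ A0 k ∧ (d ^ q ≠ d → aeval d g = c ∧
      aeval (d ^ q) g = c ^ q ∧ ∀ e, e ≠ d → e ≠ d ^ q → aeval e g = 0) := by
    intro d
    by_cases hd : d ^ q = d
    · exact ⟨0, zero_mem _, fun h => absurd hd h⟩
    · obtain ⟨g, h1, h2⟩ := exists_bump k hK c d hd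
      exact ⟨g, h1, fun _ => h2⟩
  choose g hgA hg using hg
  set S : k[X] := ∑ d ∈ Finset.univ.filter (fun d : K => d < d ^ q), b d • f.comp (g d) with hS
  have hSV : S ∈ TSp k {f} :=
    sum_mem fun d _ => Submodule.smul_mem _ _ (comp_mem_TSp k f _ (hgA d))
  have hSA : S ∈ A0 k := TSp_le_A0 k (by simpa using hf) hSV
  have hval : ∀ e d : K, d < d ^ q → aeval e (b d • f.comp (g d)) =
      if e = d then algebraMap k K (b d) * t else
      if e = d ^ q then algebraMap k K (b d) * t ^ q else 0 := by
    intro e d hd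
    obtain ⟨h1, h2, h3⟩ := hg d hd.ne'
    rw [map_smul, aeval_comp, Algebra.smul_def]
    split_ifs with h4 h5
    · rw [h4, h1]
    · rw [h5, h2, aeval_frob k hK]
    · rw [h3 e h4 h5, hf0, mul_zero]
  have hSval : ∀ e : K, aeval e S = if e < e ^ q then algebraMap k K (b e) * t else
      if e ^ q < e then algebraMap k K (b (e ^ q)) * t ^ q else 0 := by
    intro e
    rw [hS, map_sum, Finset.sum_congr rfl
      (fun d hd => hval e d (Finset.mem_filter.1 hd).2)]
    split_ifs with h1 h2
    · rw [Finset.sum_eq_single e]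
      · simp
      · intro d hd hde
        rw [if_neg hde.symm, if_neg]
        rintro rfl
        rw [pow_sq k hK] at h1
        exact absurd (Finset.mem_filter.1 hd).2 h1.not_gt
      · intro h; simp [h1] at h
    · rw [Finset.sum_eq_single (e ^ q)]
      · rw [if_neg h2.ne', if_pos (pow_sq k hK e).symm]
      · intro d hd hde
        rw [if_neg, if_neg]
        · rintro rfl; rw [pow_sq k hK] at hde; exact hde rfl
        · rintro rfl; exact h1 (Finset.mem_filter.1 hd).2
      · intro h; simp [pow_sq k hK, h2, ← hq] at h
        rw [pow_sq k hK] at h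
        exact absurd h2 h.not_gt
    · apply Finset.sum_eq_zero
      intro d hd
      have hd := (Finset.mem_filter.1 hd).2
      rw [if_neg, if_neg]
      · rintro rfl; rw [pow_sq k hK] at h2; exact h2 hd
      · rintro rfl; exact h1 hd
  have hW : P - S ∈ Wn k 1 := by
    apply mem_W_of_fixed k hK _ (sub_mem hP hSA)
    intro e
    have hbq : ∀ x : k, (algebraMap k K x) ^ q = algebraMap k K x := by
      intro x; rw [← map_pow, FiniteField.pow_card]
    rw [map_sub, sub_pow_q, hSval]
    have h5 := hb e
    have h6 := hb (e ^ q)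
    rw [aeval_frob k hK, pow_sq k hK] at h6
    split_ifs with h1 h2
    · rw [mul_pow, hbq]; linear_combination h5
    · rw [mul_pow, hbq, pow_sq k hK]; linear_combination -h6
    · have h7 : e ^ q = e := le_antisymm (not_lt.1 h1) (not_lt.1 h2)
      rw [← aeval_frob k hK, h7, zero_pow Fintype.card_ne_zero]
  have := add_mem ((le_sup_left : Wn k 1 ≤ Wn k 1 ⊔ TSp k {f}) hW)
    ((le_sup_right : TSp k {f} ≤ Wn k 1 ⊔ TSp k {f}) hSV)
  simpa using this

theorem exists_nonfixed (f : k[X]) (hf0 : f ≠ 0)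
    (hs : ∀ m ∈ f.support, ∃ i j : ℕ, j < i ∧ i < Fintype.card k ∧ m = j * Fintype.card k + i) :
    ∃ c : K, (aeval c f) ^ Fintype.card k ≠ aeval c f := by
  by_contra! hcon
  set q := Fintype.card k with hq
  have hq0 : 0 < q := Fintype.card_pos
  set L : k[X] := ∑ m ∈ f.support, monomial ((m % q) * q + m / q) (f.coeff m) with hL
  have hs' : ∀ m ∈ f.support, m / q < m % q := by
    intro m hm
    obtain ⟨i, j, h1, h2, rfl⟩ := hs m hm
    rw [add_comm, Nat.add_mul_mod_self_right, Nat.mod_eq_of_lt h2, Nat.add_mul_div_right _ _ hq0,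
      Nat.div_eq_of_lt h2]
    omega
  have hlt : ∀ m ∈ f.support, m / q + 1 < q ∧ m % q < q := fun m hm => by
    have := hs' m hm
    have := Nat.mod_lt m hq0
    omega
  have hLe : ∀ e : K, aeval e L = (aeval e f) ^ q := by
    intro e
    rw [← aeval_frob k hK, hL, map_sum, aeval_eq_sum_range, ← Polynomial.sum_over_range' (p := f)
      (f := fun n a => a • (e ^ q) ^ n) (by simp) _ (Nat.lt_succ_self _), Polynomial.sum]
    apply Finset.sum_congr rfl
    intro m hm
    rw [aeval_monomial, Algebra.smul_def]
    congr 1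
    conv_rhs => rw [← Nat.div_add_mod m q]
    rw [pow_add (e ^ q), pow_mul (e ^ q) q, pow_sq k hK, pow_add, mul_comm (m % q), pow_mul, mul_comm]
  have hfL : f - L = 0 := by
    apply eq_zero_of_vanish k (K := K)
    · rw [hK]
      have hpos : 0 < q ^ 2 := by positivity
      rw [← Nat.le_sub_one_iff_lt hpos]
      rw [← max_self (q ^ 2 - 1)]
      apply natDegree_sub_le_of_le
      · apply natDegree_le_iff_coeff_eq_zero.2
        intro n hn
        by_contra h
        have := hlt n (mem_support_iff.2 h)
        have h3 := Nat.div_add_mod n q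
        have : n < q ^ 2 := by nlinarith
        omega
      · apply natDegree_sum_le_of_forall_le
        intro m hm
        refine (natDegree_monomial_le _).trans ?_
        have := hlt m hm
        have : m % q * q + m / q < q ^ 2 := by nlinarith
        omega
    · intro e; rw [map_sub, hLe, hcon, sub_self]
  obtain ⟨m, hm⟩ := Polynomial.support_nonempty.2 hf0
  have h1 : L.coeff m = 0 := by
    rw [hL, finsetSum_coeff]
    apply Finset.sum_eq_zero
    intro n hn
    rw [coeff_monomial, if_neg]
    rintro rfl
    have h2 := hs' _ hm
    have h3 := hs' _ hn
    have h4 := hlt n hn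
    have h5 : n / q < q := by omega
    rw [add_comm, Nat.add_mul_mod_self_right, Nat.mod_eq_of_lt h5, Nat.add_mul_div_right _ _ hq0,
      Nat.div_eq_of_lt h5] at h2
    omega
  have h2 := congrArg (fun p => coeff p m) hfL
  simp [h1] at h2
  exact (mem_support_iff.1 hm) h2

end

/-- If `f` is a nonzero element of the span of
`{x^{jq+i} : q > i > j ≥ 0, jq+i ≡ 1 (mod q-1)}`, then `W_1 + {f}^S = k[x]₀`. -/
theorem W1_sup_TSp_singleton_eq_top_of_class_one (f : Polynomial k)
    (hf : f ∈ Submodule.span k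
      {p : Polynomial k | ∃ i j : ℕ, j < i ∧ i < Fintype.card k ∧
        (j * Fintype.card k + i) % (Fintype.card k - 1) = 1 % (Fintype.card k - 1) ∧
        p = X ^ (j * Fintype.card k + i)})
    (hf0 : f ≠ 0) :
    Wn k 1 ⊔ TSp k {f} = A0 k := by
  have hsub : ∀ m ∈ f.support, ∃ i j : ℕ, j < i ∧ i < Fintype.card k ∧
      m = j * Fintype.card k + i := by
    intro m hm
    by_contra hcon
    have hle : Submodule.span k
      {p : Polynomial k | ∃ i j : ℕ, j < i ∧ i < Fintype.card k ∧
        (j * Fintype.card k + i) % (Fintype.card k - 1) = 1 % (Fintype.card k - 1) ∧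
        p = X ^ (j * Fintype.card k + i)} ≤ LinearMap.ker (Polynomial.lcoeff k m) := by
      rw [Submodule.span_le]
      rintro _ ⟨i, j, h1, h2, -, rfl⟩
      simp only [SetLike.mem_coe, LinearMap.mem_ker, lcoeff_apply, coeff_X_pow]
      rw [if_neg]
      intro h
      exact hcon ⟨i, j, h1, h2, h⟩
    have := hle hf
    rw [LinearMap.mem_ker, lcoeff_apply] at this
    exact (mem_support_iff.1 hm) this
  have hfA : f ∈ A0 k := by
    rw [mem_A0_iff, ← coeff_zero_eq_eval_zero]
    by_contra h
    obtain ⟨i, j, h1, h2, h3⟩ := hsub 0 (mem_support_iff.2 h)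
    omega
  have hq : Fintype.card k ≠ 0 := Fintype.card_ne_zero
  apply le_antisymm
  · refine sup_le (sup_le ?_ ?_) ?_ <;> apply TSp_le_A0 <;> simp only [Set.singleton_subset_iff]
    · simp [mem_A0_iff, hq]
    · simp [mem_A0_iff]
    · exact hfA
  · obtain ⟨p, hp⟩ := CharP.exists k
    haveI : Fact p.Prime := ⟨CharP.char_is_prime k p⟩
    let K := FiniteField.Extension k p 2
    letI : Fintype K := Fintype.ofFinite K
    have hK : Fintype.card K = Fintype.card k ^ 2 := by
      rw [← Nat.card_eq_fintype_card, ← Nat.card_eq_fintype_card]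
      exact FiniteField.natCard_extension k p 2
    obtain ⟨c, hc⟩ := exists_nonfixed k hK f hf0 hsub
    intro P hP
    exact main_aux k hK f hfA c hc P hP
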